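/- Let a and d be positive integers, both divisible by 4, with a + d = 4t for an integer t. Equip ℤ¹⁰ with the symmetric bilinear form B(x,y) = 2·Σᵢ₌₁¹⁰ xᵢyᵢ (the lattice A₁^{⊕10}). Then there exist z₁, z₂ ∈ ℤ¹⁰ with B(z₁,z₁) = 2a, B(z₂,z₂) = 2t, B(z₁,z₂) = −a; there exists a ℤ-linear automorphism σ of ℤ¹⁰ with B(σx,σy) = B(x,y) for all x, y, σ(z₁) = −z₁, and σ(z₂) = z₁ + z₂; and the saturation S = {x ∈ ℤ¹⁰ : k·x ∈ ℤz₁ + ℤz₂ for some integer k ≥ 1} contains ℤz₁ + ℤz₂ as a subgroup of index exactly 2. -/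

import Mathlib

/-- The bilinear form of the lattice `A₁^{⊕10}` on `ℤ¹⁰`. -/
def BA110 (x y : Fin 10 → ℤ) : ℤ := 2 * ∑ i, x i * y i

theorem four_sq_aux (n : ℤ) (h : 0 < n) :
    ∃ x y z w : ℤ, 1 + (x * x + y * y + z * z + w * w) = n := by
  obtain ⟨x, y, z, w, e⟩ := Nat.sum_four_squares (n - 1).toNat
  refine ⟨x, y, z, w, ?_⟩
  have e' : ((x ^ 2 + y ^ 2 + z ^ 2 + w ^ 2 : ℕ) : ℤ) = n - 1 := by
    rw [e]; omega
  push_cast at e'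
  linarith

/-- When `4 ∣ a` and `4 ∣ d` (with `a + d = 4t`), the lattice `Q_{(a,d)}` with Gram
matrix `[[2a, −a],[−a, 2t]]` embeds into `A₁^{⊕10}` with saturation of index exactly 2,
in such a way that the reflection along `z₁` extends to an isometry of `A₁^{⊕10}`. -/
theorem stmt2 (a d t : ℤ) (ha : 0 < a) (hd : 0 < d)
    (h4a : 4 ∣ a) (h4d : 4 ∣ d) (ht : a + d = 4 * t) :
    ∃ z₁ z₂ : Fin 10 → ℤ,
      BA110 z₁ z₁ = 2 * a ∧ BA110 z₂ z₂ = 2 * t ∧ BA110 z₁ z₂ = -a ∧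
      (∃ σ : (Fin 10 → ℤ) ≃ₗ[ℤ] (Fin 10 → ℤ),
        (∀ x y, BA110 (σ x) (σ y) = BA110 x y) ∧ σ z₁ = -z₁ ∧ σ z₂ = z₁ + z₂) ∧
      (∃ w : Fin 10 → ℤ,
        (∃ k : ℤ, 1 ≤ k ∧ k • w ∈ AddSubgroup.closure {z₁, z₂}) ∧
        w ∉ AddSubgroup.closure {z₁, z₂} ∧
        ∀ x : Fin 10 → ℤ,
          (∃ k : ℤ, 1 ≤ k ∧ k • x ∈ AddSubgroup.closure {z₁, z₂}) →
          (x ∈ AddSubgroup.closure {z₁, z₂} ∨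
            x - w ∈ AddSubgroup.closure {z₁, z₂})) := by
  obtain ⟨a', rfl⟩ := h4a
  obtain ⟨d', rfl⟩ := h4d
  obtain ⟨x1, x2, x3, x4, hx⟩ := four_sq_aux a' (by omega)
  obtain ⟨y1, y2, y3, y4, hy⟩ := four_sq_aux d' (by omega)
  have htt : t = a' + d' := by omega
  have E : ∀ u v : Fin 10 → ℤ, (u = v ↔ u 0 = v 0 ∧ u 1 = v 1 ∧ u 2 = v 2 ∧ u 3 = v 3 ∧ u 4 = v 4
      ∧ u 5 = v 5 ∧ u 6 = v 6 ∧ u 7 = v 7 ∧ u 8 = v 8 ∧ u 9 = v 9) := by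
    intro u v
    constructor
    · rintro rfl; simp
    · rintro ⟨h0, h1, h2, h3, h4, h5, h6, h7, h8, h9⟩
      funext i
      fin_cases i <;> assumption
  obtain ⟨p, hp⟩ : ∃ p : Fin 10 → ℤ, p = ![1, x1, x2, x3, x4, 0, 0, 0, 0, 0] := ⟨_, rfl⟩
  obtain ⟨q, hq⟩ : ∃ q : Fin 10 → ℤ, q = ![0, 0, 0, 0, 0, 1, y1, y2, y3, y4] := ⟨_, rfl⟩
  obtain ⟨e, he⟩ : ∃ e : Fin 10 → ℤ, e = ![-1, -1, -1, -1, -1, 1, 1, 1, 1, 1] := ⟨_, rfl⟩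
  have p0 : p 0 = 1 := by simp [hp]
  have p5 : p 5 = 0 := by simp [hp]
  have q0 : q 0 = 0 := by simp [hq]
  have q5 : q 5 = 1 := by simp [hq]
  have ee : ∀ i, e i * e i = 1 := by
    intro i; subst he; fin_cases i <;> rfl
  have ep : e * p = -p := by
    rw [E]; simp [he, hp]
  have eq : e * q = q := by
    rw [E]; simp [he, hq]
  have hpp : ∑ i, p i * p i = a' := by
    simp [Fin.sum_univ_succ, hp]; linarith
  have hqq : ∑ i, q i * q i = d' := by
    simp [Fin.sum_univ_succ, hq]; linarith
  have hpq : ∑ i, p i * q i = 0 := by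
    simp [Fin.sum_univ_succ, hp, hq]
  refine ⟨(2 : ℤ) • p, q - p, ?_, ?_, ?_, ⟨LinearEquiv.ofInvolutive
    { toFun := fun x => e * x
      map_add' := fun x y => mul_add e x y
      map_smul' := fun c x => mul_smul_comm c e x } ?_, ?_, ?_, ?_⟩, p, ⟨2, by norm_num, ?_⟩, ?_, ?_⟩
  · have : ∑ i, ((2 : ℤ) • p) i * ((2 : ℤ) • p) i = 4 * ∑ i, p i * p i := by
      rw [Finset.mul_sum]
      refine Finset.sum_congr rfl fun i _ => ?_
      simp only [Pi.smul_apply, smul_eq_mul]; ring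
    rw [BA110, this, hpp]
  · have : ∑ i, (q - p) i * (q - p) i
        = ∑ i, q i * q i - 2 * ∑ i, p i * q i + ∑ i, p i * p i := by
      rw [Finset.mul_sum, ← Finset.sum_sub_distrib, ← Finset.sum_add_distrib]
      refine Finset.sum_congr rfl fun i _ => ?_
      simp only [Pi.sub_apply]; ring
    rw [BA110, this, hpp, hqq, hpq, htt]; ring
  · have : ∑ i, ((2 : ℤ) • p) i * (q - p) i
        = 2 * ∑ i, p i * q i - 2 * ∑ i, p i * p i := by
      rw [Finset.mul_sum, Finset.mul_sum, ← Finset.sum_sub_distrib]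
      refine Finset.sum_congr rfl fun i _ => ?_
      simp only [Pi.sub_apply, Pi.smul_apply, smul_eq_mul]; ring
    rw [BA110, this, hpp, hpq]; ring
  · intro x
    funext i
    change e i * (e i * x i) = x i
    rw [← mul_assoc, ee, one_mul]
  · intro x y
    change 2 * ∑ i, (e i * x i) * (e i * y i) = 2 * ∑ i, x i * y i
    congr 1
    refine Finset.sum_congr rfl fun i _ => ?_
    linear_combination (x i * y i) * ee i
  · change e * ((2 : ℤ) • p) = _
    rw [mul_smul_comm, ep, smul_neg]
  · change e * (q - p) = _
    rw [mul_sub, ep, eq, two_smul]; abel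
  · exact AddSubgroup.subset_closure (by simp)
  · rw [AddSubgroup.mem_closure_pair]
    rintro ⟨m, n, h⟩
    have h0 := congrFun h 0
    have h5 := congrFun h 5
    simp [p0, p5, q0, q5] at h0 h5
    omega
  · rintro x ⟨k, hk, hx⟩
    rw [AddSubgroup.mem_closure_pair] at hx
    obtain ⟨m, n, h⟩ := hx
    have h0 := congrFun h 0
    have h5 := congrFun h 5
    simp [p0, p5, q0, q5] at h0 h5
    have key : ∀ i, x i = x 0 * p i + x 5 * q i := by
      intro i
      have hi := congrFun h i
      simp at hi
      have hk0 : k ≠ 0 := by omega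
      apply mul_left_cancel₀ hk0
      linear_combination -hi + p i * h0 + q i * h5
    rw [AddSubgroup.mem_closure_pair, AddSubgroup.mem_closure_pair]
    rcases Int.even_or_odd' (x 0 + x 5) with ⟨c, hc | hc⟩
    · left
      refine ⟨c, x 5, ?_⟩
      funext i
      simp
      linear_combination -key i - p i * hc
    · right
      refine ⟨c, x 5, ?_⟩
      funext i
      simp
      linear_combination -key i - p i * hc
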